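/- arXiv:1710.00608 — 11 statements merged into one kernel-verified Lean document; each statement's English description precedes it below -/
import Mathlib

section
/- For every integer n ≥ 1 and every α ∈ (0,1), the truncated geometric mechanism GM of size n is a valid mechanism (all entries are nonnegative and each column sums to 1) and satisfies α-differential privacy. -/
open Finset

/-- A mechanism of size `n`: entries indexed by `{0,…,n}×{0,…,n}` are nonnegative
and each column sums to 1. `P i j` is the probability of output `i` on input `j`. -/
def IsMechanism (n : ℕ) (P : ℕ → ℕ → ℝ) : Prop :=
  (∀ i j, i ≤ n → j ≤ n → 0 ≤ P i j) ∧
  (∀ j, j ≤ n → ∑ i ∈ Finset.range (n + 1), P i j = 1)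

/-- `α`-differential privacy: for all rows `i` and adjacent columns `j`, `j+1`,
`α·P i (j+1) ≤ P i j` and `α·P i j ≤ P i (j+1)`. -/
def IsDP (n : ℕ) (α : ℝ) (P : ℕ → ℕ → ℝ) : Prop :=
  ∀ i j, i ≤ n → j < n → α * P i (j + 1) ≤ P i j ∧ α * P i j ≤ P i (j + 1)

/-- Trace of a mechanism of size `n`. -/
noncomputable def mechTrace (n : ℕ) (P : ℕ → ℕ → ℝ) : ℝ :=
  ∑ i ∈ Finset.range (n + 1), P i i

/-- The truncated geometric mechanism: `GM i j = x·α^|i−j|` if `i = 0` or `i = n`,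
and `y·α^|i−j|` otherwise, where `x = 1/(1+α)`, `y = (1−α)/(1+α)`. -/
noncomputable def GM (n : ℕ) (α : ℝ) (i j : ℕ) : ℝ :=
  (if i = 0 ∨ i = n then 1 / (1 + α) else (1 - α) / (1 + α)) * α ^ Nat.dist i j

/-- The explicit fair mechanism: `EM i j = y·α^|i−j|` if `|i−j| < min(j, n−j)`,
and `y·α^⌈(|i−j|+min(j,n−j))/2⌉` otherwise, where `y = (1−α)/(1+α−2α^(n/2+1))`. -/
noncomputable def EM (n : ℕ) (α : ℝ) (i j : ℕ) : ℝ :=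
  (1 - α) / (1 + α - 2 * α ^ (n / 2 + 1)) *
    (if Nat.dist i j < min j (n - j) then α ^ Nat.dist i j
     else α ^ ((Nat.dist i j + min j (n - j) + 1) / 2))

/-- Row monotone: entries in each row are nonincreasing moving away from the diagonal. -/
def RowMonotone (n : ℕ) (P : ℕ → ℕ → ℝ) : Prop :=
  (∀ i j, 1 ≤ j → j ≤ i → i ≤ n → P i (j - 1) ≤ P i j) ∧
  (∀ i j, i ≤ j → j < n → P i (j + 1) ≤ P i j)

/-- Column monotone: entries in each column are nonincreasing moving away from the diagonal. -/
def ColMonotone (n : ℕ) (P : ℕ → ℕ → ℝ) : Prop :=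
  (∀ i j, 1 ≤ i → i ≤ j → j ≤ n → P (i - 1) j ≤ P i j) ∧
  (∀ i j, j ≤ i → i < n → P (i + 1) j ≤ P i j)

/-- Row honesty: `P i i ≥ P i j` for all `i, j`. -/
def RowHonest (n : ℕ) (P : ℕ → ℕ → ℝ) : Prop :=
  ∀ i j, i ≤ n → j ≤ n → P i j ≤ P i i

/-- Column honesty: `P j j ≥ P i j` for all `i, j`. -/
def ColHonest (n : ℕ) (P : ℕ → ℕ → ℝ) : Prop :=
  ∀ i j, i ≤ n → j ≤ n → P i j ≤ P j j

/-- Weak honesty: `P i i ≥ 1/(n+1)` for all `i`. -/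
def WeaklyHonest (n : ℕ) (P : ℕ → ℕ → ℝ) : Prop :=
  ∀ i, i ≤ n → 1 / ((n : ℝ) + 1) ≤ P i i

/-- Fairness: all diagonal entries are equal. -/
def Fair (n : ℕ) (P : ℕ → ℕ → ℝ) : Prop :=
  ∀ i j, i ≤ n → j ≤ n → P i i = P j j

/-- Below the diagonal entry, the partial column sums of `GM` form a geometric sequence. -/
lemma sum_range_GM_add (n : ℕ) (α : ℝ) (hα : 0 < α) (k d : ℕ) (hk : k < n) :
    ∑ i ∈ Finset.range (k + 1), GM n α i (k + d) = 1 / (1 + α) * α ^ d := by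
  induction k generalizing d with
  | zero => simp [GM, Nat.dist]
  | succ k ih =>
    have hne : ¬ (k + 1 = 0 ∨ k + 1 = n) := by omega
    have hd : Nat.dist (k + 1) (k + 1 + d) = d := by simp only [Nat.dist]; omega
    rw [Finset.sum_range_succ, show k + 1 + d = k + (d + 1) by omega, ih (d + 1) (by omega), GM,
      if_neg hne, ← show k + 1 + d = k + (d + 1) by omega, hd]
    field_simp
    ring

/-- From the diagonal entry on, the partial column sums of `GM` approach `1` geometrically. -/
lemma sum_range_GM_of_add (n : ℕ) (α : ℝ) (hα : 0 < α) (j d : ℕ) (hk : j + d < n) :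
    ∑ i ∈ Finset.range (j + d + 1), GM n α i j = 1 - α ^ (d + 1) / (1 + α) := by
  induction d with
  | zero =>
    have h := sum_range_GM_add n α hα j 0 hk
    simp only [Nat.add_zero] at h ⊢
    rw [h]
    field_simp
    ring
  | succ d ih =>
    have hne : ¬ (j + d + 1 = 0 ∨ j + d + 1 = n) := by omega
    have hd : Nat.dist (j + d + 1) j = d + 1 := by simp only [Nat.dist]; omega
    rw [← Nat.add_assoc, Finset.sum_range_succ, ih (by omega), GM, if_neg hne, hd]
    field_simp
    ring

/-- The columns of `GM` sum to `1`. -/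
lemma sum_GM_column (n : ℕ) (α : ℝ) (hn : 1 ≤ n) (hα : 0 < α) (j : ℕ) (hj : j ≤ n) :
    ∑ i ∈ Finset.range (n + 1), GM n α i j = 1 := by
  rw [Finset.sum_range_succ, GM, if_pos (Or.inr rfl)]
  rcases hj.eq_or_lt with rfl | hlt
  · obtain ⟨m, rfl⟩ := Nat.exists_eq_add_of_le' hn
    rw [sum_range_GM_add (m + 1) α hα m 1 (by omega), Nat.dist_self]
    field_simp
    ring
  · obtain ⟨d, rfl⟩ := Nat.exists_eq_add_of_lt hlt
    have hd : Nat.dist (j + d + 1) j = d + 1 := by simp only [Nat.dist]; omega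
    rw [sum_range_GM_of_add (j + d + 1) α hα j d (by omega), hd]
    ring

/-- If `a ≤ b + 1`, then `α * α ^ b ≤ α ^ a` for `0 ≤ α ≤ 1`, also after scaling. -/
lemma mul_mul_pow_le_mul_pow {α c : ℝ} (hα0 : 0 ≤ α) (hα1 : α ≤ 1) (hc : 0 ≤ c) {a b : ℕ}
    (h : a ≤ b + 1) : α * (c * α ^ b) ≤ c * α ^ a := by
  rw [mul_left_comm, ← pow_succ']
  exact mul_le_mul_of_nonneg_left (pow_le_pow_of_le_one hα0 hα1 h) hc

/-- for every `n ≥ 1` and `α ∈ (0,1)`, `GM` is a valid mechanism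
and satisfies `α`-differential privacy. -/
theorem gm_is_mechanism_and_dp (n : ℕ) (α : ℝ) (hn : 1 ≤ n) (hα0 : 0 < α) (hα1 : α < 1) :
    IsMechanism n (GM n α) ∧ IsDP n α (GM n α) := by
  have hcoef : ∀ i : ℕ,
      0 ≤ (if i = 0 ∨ i = n then 1 / (1 + α) else (1 - α) / (1 + α) : ℝ) := by
    intro i
    have : 0 ≤ 1 - α := by linarith
    split_ifs <;> positivity
  refine ⟨⟨fun i j _ _ => mul_nonneg (hcoef i) (by positivity), sum_GM_column n α hn hα0⟩,
    fun i j _ _ => ⟨?_, ?_⟩⟩ <;>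
  · refine mul_mul_pow_le_mul_pow hα0.le hα1.le (hcoef i) ?_
    simp only [Nat.dist]
    omega
end

section
/- For every integer n ≥ 1 and every α ∈ (0,1), the truncated geometric mechanism GM is the unique optimal mechanism under the L0 objective among all α-differentially private mechanisms: every mechanism P of size n satisfying α-differential privacy has trace(P) ≤ trace(GM), and if trace(P) = trace(GM) then P = GM. -/
open Finset

lemma gm_eq_diag_mul (n : ℕ) (α : ℝ) (i j : ℕ) :
    GM n α i j = GM n α i i * α ^ Nat.dist i j := by
  simp [GM]

lemma gm_diag_pos (n : ℕ) {α : ℝ} (hα0 : 0 < α) (hα1 : α < 1) (i : ℕ) : 0 < GM n α i i := by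
  have h : 0 < 1 - α := sub_pos.mpr hα1
  simp only [GM, Nat.dist_self, pow_zero, mul_one]
  split_ifs <;> positivity

/-- The mass that `GM` puts on the outputs `0, …, m` when the input is `m + k`. -/
lemma sum_gm_below {n m : ℕ} {α : ℝ} (hm : m < n) (k : ℕ) :
    ∑ i ∈ range (m + 1), GM n α i (m + k) = α ^ k / (1 + α) := by
  induction m generalizing k with
  | zero => simp [GM, Nat.dist]; ring
  | succ m ih =>
    have h1 : m + 1 ≠ n := by omega
    have hd : Nat.dist (m + 1) (m + 1 + k) = k := by simp only [Nat.dist]; omega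
    rw [sum_range_succ, show m + 1 + k = m + (k + 1) by ring, ih (by omega),
      show m + (k + 1) = m + 1 + k by ring]
    simp only [GM, hd, h1, Nat.succ_ne_zero, or_self, if_false]
    ring

/-- The mass that `GM` puts on the outputs `0, …, j + k` when the input is `j`. -/
lemma sum_gm_above {n j k : ℕ} {α : ℝ} (hα0 : 0 < α) (hk : j + k < n) :
    ∑ i ∈ range (j + k + 1), GM n α i j = 1 - α ^ (k + 1) / (1 + α) := by
  induction k with
  | zero =>
    have h := sum_gm_below (α := α) hk 0
    simp only [add_zero] at h ⊢
    rw [h]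
    field_simp
    ring
  | succ k ih =>
    have h1 : j + (k + 1) ≠ n := by omega
    have hd : Nat.dist (j + (k + 1)) j = k + 1 := by simp only [Nat.dist]; omega
    have h0 : j + (k + 1) ≠ 0 := by omega
    rw [sum_range_succ, ← add_assoc, ih (by omega), add_assoc]
    simp only [GM, hd, h1, h0, or_self, if_false]
    field_simp
    ring

lemma sum_gm {n j : ℕ} {α : ℝ} (hα0 : 0 < α) (hn : 1 ≤ n) (hj : j ≤ n) :
    ∑ i ∈ range (n + 1), GM n α i j = 1 := by
  rcases hj.eq_or_lt with rfl | hj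
  · obtain ⟨m, rfl⟩ : ∃ m, j = m + 1 := ⟨j - 1, by omega⟩
    rw [sum_range_succ, sum_gm_below (Nat.lt_succ_self m)]
    simp only [GM, or_true, if_true, Nat.dist_self]
    field_simp
    ring
  · obtain ⟨k, rfl⟩ : ∃ k, n = j + k + 1 := ⟨n - j - 1, by omega⟩
    have hd : Nat.dist (j + k + 1) j = k + 1 := by simp only [Nat.dist]; omega
    rw [sum_range_succ, sum_gm_above hα0 (Nat.lt_succ_self _)]
    simp only [GM, or_true, if_true, hd]
    field_simp
    ring

lemma IsDP.pow_dist_mul_diag_le {n : ℕ} {α : ℝ} {P : ℕ → ℕ → ℝ} (hdp : IsDP n α P)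
    (hα0 : 0 < α) {i j : ℕ} (hi : i ≤ n) (hj : j ≤ n) :
    α ^ Nat.dist i j * P i i ≤ P i j := by
  have right (k : ℕ) (hk : i + k ≤ n) : α ^ k * P i i ≤ P i (i + k) := by
    induction k with
    | zero => simp
    | succ k ih =>
      calc α ^ (k + 1) * P i i = α * (α ^ k * P i i) := by ring
        _ ≤ α * P i (i + k) := by gcongr; exact ih (by omega)
        _ ≤ P i (i + (k + 1)) := (hdp i (i + k) hi (by omega)).2
  have left (k : ℕ) (l : ℕ) (hk : l + k = i) : α ^ k * P i i ≤ P i l := by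
    induction k generalizing l with
    | zero => simp [← hk]
    | succ k ih =>
      calc α ^ (k + 1) * P i i = α * (α ^ k * P i i) := by ring
        _ ≤ α * P i (l + 1) := by gcongr; exact ih (l + 1) (by omega)
        _ ≤ P i l := (hdp i l hi (by omega)).1
  rcases le_total i j with h | h
  · rw [Nat.dist_eq_sub_of_le h]
    simpa [h] using right (j - i) (by omega)
  · rw [Nat.dist_eq_sub_of_le_right h]
    exact left (i - j) j (by omega)

/-- The gap between the traces of `GM` and `P` is a positive combination of the slacks in
`α ^ |i - j| * P i i ≤ P i j`. -/
lemma trace_gm_sub_trace {n : ℕ} {α : ℝ} (hα0 : 0 < α) (hn : 1 ≤ n) {P : ℕ → ℕ → ℝ}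
    (hP : IsMechanism n P) :
    mechTrace n (GM n α) - mechTrace n P =
      ∑ j ∈ range (n + 1), ∑ i ∈ range (n + 1),
        GM n α j j * (P i j - α ^ Nat.dist i j * P i i) := by
  have hle {k : ℕ} (hk : k ∈ range (n + 1)) : k ≤ n := Nat.le_of_lt_succ (mem_range.mp hk)
  simp only [mul_sub, sum_sub_distrib]
  congr 1
  · refine sum_congr rfl fun j hj ↦ ?_
    rw [← mul_sum, hP.2 j (hle hj), mul_one]
  · rw [sum_comm]
    refine sum_congr rfl fun i hi ↦ ?_
    calc P i i = ∑ j ∈ range (n + 1), GM n α j i * P i i := by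
          rw [← sum_mul, sum_gm hα0 hn (hle hi), one_mul]
      _ = ∑ j ∈ range (n + 1), GM n α j j * (α ^ Nat.dist i j * P i i) :=
          sum_congr rfl fun j _ ↦ by
            rw [gm_eq_diag_mul n α j i, Nat.dist_comm i j, mul_assoc]

/-- The matrix `α ^ |i - j|` is nonsingular: its only solution with all column sums equal to `1`
is the diagonal of `GM`. -/
lemma eq_gm_diag_of_sum_eq_one {n : ℕ} {α : ℝ} (hα0 : 0 < α) (hα1 : α < 1) (hn : 1 ≤ n)
    {d : ℕ → ℝ} (hd : ∀ j ≤ n, ∑ i ∈ range (n + 1), α ^ Nat.dist i j * d i = 1)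
    {j : ℕ} (hj : j ≤ n) : d j = GM n α j j := by
  have hj' : j ∈ range (n + 1) := mem_range.mpr (by omega)
  have hα : (1 - α) ≠ 0 := (sub_pos.mpr hα1).ne'
  simp only [GM, Nat.dist_self, pow_zero, mul_one]
  -- An end column minus `α` times its neighbour isolates the end entry.
  have endpoint (l : ℕ) (hl : l ≤ n)
      (h : ∀ i ≤ n, i ≠ j → Nat.dist i j = Nat.dist i l + 1) (hjl : Nat.dist j l = 1) :
      d j = 1 / (1 + α) := by
    have key : ∑ i ∈ range (n + 1), (α ^ Nat.dist i j * d i - α * (α ^ Nat.dist i l * d i))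
        = (1 - α ^ 2) * d j := by
      rw [sum_eq_single_of_mem j hj']
      · rw [hjl, Nat.dist_self]; ring
      · intro i hi hij
        rw [h i (Nat.le_of_lt_succ (mem_range.mp hi)) hij]; ring
    rw [sum_sub_distrib, ← mul_sum, hd j hj, hd l hl] at key
    rw [eq_div_iff (by positivity)]
    apply mul_left_cancel₀ hα
    linarith
  split_ifs with h
  · rcases h with rfl | rfl
    · exact endpoint 1 hn (fun i _ _ ↦ by simp only [Nat.dist]; omega) (by simp [Nat.dist])
    · exact endpoint (j - 1) (by omega) (fun i _ _ ↦ by simp only [Nat.dist]; omega)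
        (by simp only [Nat.dist]; omega)
  · obtain ⟨m, rfl⟩ : ∃ m, j = m + 1 := ⟨j - 1, by omega⟩
    have key : ∑ i ∈ range (n + 1), ((1 + α ^ 2) * (α ^ Nat.dist i (m + 1) * d i)
          - α * (α ^ Nat.dist i m * d i) - α * (α ^ Nat.dist i (m + 2) * d i))
        = (1 - α ^ 2) * d (m + 1) := by
      rw [sum_eq_single_of_mem (m + 1) hj']
      · have h1 : Nat.dist (m + 1) m = 1 := by simp only [Nat.dist]; omega
        have h2 : Nat.dist (m + 1) (m + 2) = 1 := by simp only [Nat.dist]; omega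
        rw [h1, h2, Nat.dist_self]; ring
      · intro i _ hij
        rcases Nat.lt_or_gt_of_ne hij with hlt | hgt
        · have h1 : Nat.dist i (m + 1) = Nat.dist i m + 1 := by simp only [Nat.dist]; omega
          have h2 : Nat.dist i (m + 2) = Nat.dist i m + 2 := by simp only [Nat.dist]; omega
          rw [h1, h2]; ring
        · have h1 : Nat.dist i (m + 1) = Nat.dist i (m + 2) + 1 := by
            simp only [Nat.dist]; omega
          have h2 : Nat.dist i m = Nat.dist i (m + 2) + 2 := by simp only [Nat.dist]; omega
          rw [h1, h2]; ring
    rw [sum_sub_distrib, sum_sub_distrib, ← mul_sum, ← mul_sum, ← mul_sum, hd _ hj,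
      hd m (by omega), hd (m + 2) (by omega)] at key
    rw [eq_div_iff (by positivity)]
    apply mul_left_cancel₀ hα
    linarith

/-- `GM` is the unique optimal mechanism under the `L0` objective among
all `α`-DP mechanisms: any such `P` has `trace(P) ≤ trace(GM)`, with equality only if `P = GM`. -/
theorem gm_unique_optimal (n : ℕ) (α : ℝ) (hn : 1 ≤ n) (hα0 : 0 < α) (hα1 : α < 1)
    (P : ℕ → ℕ → ℝ) (hP : IsMechanism n P) (hdp : IsDP n α P) :
    mechTrace n P ≤ mechTrace n (GM n α) ∧
      (mechTrace n P = mechTrace n (GM n α) →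
        ∀ i j, i ≤ n → j ≤ n → P i j = GM n α i j) := by
  have hle {k : ℕ} (hk : k ∈ range (n + 1)) : k ≤ n := Nat.le_of_lt_succ (mem_range.mp hk)
  have hmem {k : ℕ} (hk : k ≤ n) : k ∈ range (n + 1) := mem_range.mpr (Nat.lt_succ_of_le hk)
  have hgap := trace_gm_sub_trace hα0 hn hP
  have hnonneg : ∀ j ∈ range (n + 1), ∀ i ∈ range (n + 1),
      0 ≤ GM n α j j * (P i j - α ^ Nat.dist i j * P i i) := fun j hj i hi ↦
    mul_nonneg (gm_diag_pos n hα0 hα1 j).le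
      (sub_nonneg.mpr (hdp.pow_dist_mul_diag_le hα0 (hle hi) (hle hj)))
  refine ⟨sub_nonneg.mp (hgap ▸ sum_nonneg fun j hj ↦ sum_nonneg (hnonneg j hj)), fun heq ↦ ?_⟩
  rw [heq, sub_self, eq_comm,
    sum_eq_zero_iff_of_nonneg fun j hj ↦ sum_nonneg (hnonneg j hj)] at hgap
  have htight (i j : ℕ) (hi : i ≤ n) (hj : j ≤ n) : P i j = α ^ Nat.dist i j * P i i := by
    have h := (sum_eq_zero_iff_of_nonneg (hnonneg j (hmem hj))).mp (hgap j (hmem hj)) i (hmem hi)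
    exact sub_eq_zero.mp ((mul_eq_zero.mp h).resolve_left (gm_diag_pos n hα0 hα1 j).ne')
  intro i j hi hj
  have hdiag : P i i = GM n α i i :=
    eq_gm_diag_of_sum_eq_one (d := fun i ↦ P i i) hα0 hα1 hn
      (fun j hj ↦ (sum_congr rfl fun i hi ↦ (htight i j (hle hi) hj).symm).trans (hP.2 j hj)) hi
  rw [htight i j hi hj, hdiag, gm_eq_diag_mul n α i j, mul_comm]
end

section
/- For every integer n ≥ 1 and every α ∈ (0,1), the L0 score of the truncated geometric mechanism GM equals 2α/(1+α), i.e., ((n+1) − trace(GM))/n = 2α/(1+α). -/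
open Finset

/-- The diagonal of `GM` has two corner entries `1/(1+α)` and `n - 1` entries `(1-α)/(1+α)`. -/
theorem mechTrace_GM_succ (m : ℕ) (α : ℝ) :
    mechTrace (m + 1) (GM (m + 1) α) = m * ((1 - α) / (1 + α)) + 2 * (1 / (1 + α)) := by
  have interior : ∀ i ∈ Finset.range m,
      GM (m + 1) α (i + 1) (i + 1) = (1 - α) / (1 + α) := by
    intro i hi
    have hne : i ≠ m := (Finset.mem_range.mp hi).ne
    simp [GM, Nat.dist_self, hne]
  rw [mechTrace, Finset.sum_range_succ, Finset.sum_range_succ', Finset.sum_congr rfl interior]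
  simp only [GM, Nat.dist_self, Finset.sum_const, Finset.card_range, nsmul_eq_mul, true_or,
    or_true, if_true, pow_zero]
  ring

/-- the `L0` score of `GM` equals `2α/(1+α)`. -/
theorem gm_l0_score (n : ℕ) (α : ℝ) (hn : 1 ≤ n) (hα0 : 0 < α) (hα1 : α < 1) :
    (((n : ℝ) + 1) - mechTrace n (GM n α)) / n = 2 * α / (1 + α) := by
  obtain ⟨m, rfl⟩ : ∃ m, n = m + 1 := ⟨n - 1, by omega⟩
  have hpos : 1 + α ≠ 0 := by positivity
  rw [mechTrace_GM_succ]
  push_cast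
  field_simp
  ring
end

section
/- For every integer n ≥ 2 and every α ∈ (0,1), the truncated geometric mechanism GM is column monotone if and only if α ≤ 1/2. -/
open Finset

/-- For `α ≤ 1/2`, an entry of `GM` is at most any entry of the same column that is one step
closer to the diagonal. -/
theorem GM_le_of_dist_eq_succ {n : ℕ} {α : ℝ} (hα0 : 0 < α) (hα : α ≤ 1 / 2) {a b j : ℕ}
    (h : Nat.dist a j = Nat.dist b j + 1) : GM n α a j ≤ GM n α b j := by
  have hpos : 0 < 1 + α := by linarith
  have hyx : (1 - α) / (1 + α) ≤ 1 / (1 + α) := by gcongr; linarith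
  have hxy : 1 / (1 + α) * α ≤ (1 - α) / (1 + α) := by
    rw [div_mul_eq_mul_div]; gcongr; linarith
  unfold GM
  rw [h, pow_succ', ← mul_assoc]
  refine mul_le_mul_of_nonneg_right ?_ (by positivity)
  calc _ ≤ 1 / (1 + α) * α := by
        refine mul_le_mul_of_nonneg_right ?_ hα0.le
        split_ifs <;> linarith
    _ ≤ (1 - α) / (1 + α) := hxy
    _ ≤ _ := by split_ifs <;> linarith

/-- for `n ≥ 2`, `GM` is column monotone iff `α ≤ 1/2`. -/
theorem gm_col_monotone_iff (n : ℕ) (α : ℝ) (hn : 2 ≤ n) (hα0 : 0 < α) (hα1 : α < 1) :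
    ColMonotone n (GM n α) ↔ α ≤ 1 / 2 := by
  constructor
  · rintro ⟨h, -⟩
    have h01 := h 1 1 le_rfl le_rfl (by omega)
    have hn1 : 1 ≠ n := by omega
    have hpos : 0 < 1 + α := by linarith
    simp only [GM, Nat.sub_self, Nat.dist, true_or, if_true, one_ne_zero, hn1, or_self,
      if_false, div_mul_eq_mul_div] at h01
    rw [div_le_div_iff_of_pos_right hpos] at h01
    norm_num at h01
    linarith
  · intro hα
    refine ⟨fun i j hi hij _ => ?_, fun i j hji _ => ?_⟩ <;>
      refine GM_le_of_dist_eq_succ hα0 hα ?_ <;> unfold Nat.dist <;> omega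
end

section
/- Let n ≥ 2 be even, α ∈ (0,1), and let P be a fair mechanism of size n satisfying α-differential privacy with common diagonal value y. Then y ≤ (1−α)/(1+α−2α^{n/2+1}). -/
open Finset

/-- Moving `d` columns to the right of `j` loses at most a factor `α ^ d`. -/
lemma IsDP.pow_mul_le_add {n : ℕ} {α : ℝ} {P : ℕ → ℕ → ℝ} (h : IsDP n α P) (hα : 0 ≤ α)
    {i j : ℕ} (hi : i ≤ n) (d : ℕ) (hd : j + d ≤ n) : α ^ d * P i j ≤ P i (j + d) := by
  induction d with
  | zero => simp
  | succ d ih =>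
    calc α ^ (d + 1) * P i j = α * (α ^ d * P i j) := by ring
      _ ≤ α * P i (j + d) := mul_le_mul_of_nonneg_left (ih (by omega)) hα
      _ ≤ P i (j + d + 1) := (h i (j + d) hi (by omega)).2

/-- Moving `d` columns to the left of `j + d` loses at most a factor `α ^ d`. -/
lemma IsDP.pow_mul_add_le {n : ℕ} {α : ℝ} {P : ℕ → ℕ → ℝ} (h : IsDP n α P) (hα : 0 ≤ α)
    {i j : ℕ} (hi : i ≤ n) (d : ℕ) (hd : j + d ≤ n) : α ^ d * P i (j + d) ≤ P i j := by
  induction d with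
  | zero => simp
  | succ d ih =>
    calc α ^ (d + 1) * P i (j + (d + 1)) = α ^ d * (α * P i (j + d + 1)) := by
          rw [← add_assoc]; ring
      _ ≤ α ^ d * P i (j + d) :=
          mul_le_mul_of_nonneg_left (h i (j + d) hi (by omega)).1 (pow_nonneg hα d)
      _ ≤ P i j := ih (by omega)

/-- for even `n ≥ 2` and a fair `α`-DP mechanism with common diagonal
value `y`, we have `y ≤ (1−α)/(1+α−2α^(n/2+1))`. -/
theorem fair_dp_diag_bound (n : ℕ) (α : ℝ) (hn : 2 ≤ n) (heven : Even n)
    (hα0 : 0 < α) (hα1 : α < 1) (P : ℕ → ℕ → ℝ) (y : ℝ)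
    (hP : IsMechanism n P) (hdp : IsDP n α P) (hfair : ∀ i, i ≤ n → P i i = y) :
    y ≤ (1 - α) / (1 + α - 2 * α ^ (n / 2 + 1)) := by
  obtain ⟨k, rfl⟩ := heven
  rw [show (k + k) / 2 = k by omega]
  have hsum := hP.2 k (by omega)
  rw [add_assoc, Finset.sum_range_add, ← Finset.sum_range_reflect] at hsum
  have hleft : ∑ d ∈ range k, α ^ (d + 1) * y ≤ ∑ d ∈ range k, P (k - 1 - d) k := by
    refine Finset.sum_le_sum fun d hd => ?_
    have hdk := Finset.mem_range.mp hd
    have hle := hdp.pow_mul_le_add hα0.le (i := k - 1 - d) (j := k - 1 - d)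
      (by omega) (d + 1) (by omega)
    rwa [hfair _ (by omega), show k - 1 - d + (d + 1) = k by omega] at hle
  have hright : ∑ d ∈ range (k + 1), α ^ d * y ≤ ∑ d ∈ range (k + 1), P (k + d) k := by
    refine Finset.sum_le_sum fun d hd => ?_
    have hdk := Finset.mem_range.mp hd
    have hle := hdp.pow_mul_add_le hα0.le (i := k + d) (j := k) (by omega) d (by omega)
    rwa [hfair _ (by omega)] at hle
  rw [← Finset.sum_mul] at hleft hright
  simp_rw [pow_succ, ← Finset.sum_mul] at hleft
  have hgeom := mul_neg_geom_sum α k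
  have hgeom' := mul_neg_geom_sum α (k + 1)
  have hpow : α ^ (k + 1) < α := by
    simpa using pow_lt_pow_right_of_lt_one₀ hα0 hα1 (show 1 < k + 1 by omega)
  rw [le_div_iff₀ (by linarith)]
  calc y * (1 + α - 2 * α ^ (k + 1))
      = (1 - α) * ((∑ d ∈ range k, α ^ d) * α * y + (∑ d ∈ range (k + 1), α ^ d) * y) := by
        linear_combination (-α * y) * hgeom - y * hgeom'
    _ ≤ (1 - α) * 1 := mul_le_mul_of_nonneg_left (by linarith) (by linarith)
    _ = 1 - α := mul_one _
end

section
/- Let n ≥ 2 be even and α ∈ (0,1). The explicit fair mechanism EM is a valid mechanism: all its entries are positive and each of its columns sums to 1. -/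
open Finset

/-- Reflecting both indices leaves `EM` unchanged. -/
lemma EM_reflect (n : ℕ) (α : ℝ) {i j : ℕ} (hi : i ≤ n) (hj : j ≤ n) :
    EM n α (n - i) (n - j) = EM n α i j := by
  have hd : Nat.dist (n - i) (n - j) = Nat.dist i j := by unfold Nat.dist; omega
  have hm : min (n - j) (n - (n - j)) = min j (n - j) := by omega
  rw [EM, EM, hd, hm]

/-- The denominator in the definition of `EM` is positive. -/
lemma EM_denom_pos (m : ℕ) {α : ℝ} (hα0 : 0 < α) (hα1 : α < 1) :
    0 < 1 + α - 2 * α ^ (m + 1) := by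
  have h : α ^ (m + 1) ≤ α := by
    rw [pow_succ]
    exact mul_le_of_le_one_left hα0.le (pow_le_one₀ hα0.le hα1.le)
  linarith

lemma one_sub_mul_sum_pow_half (α : ℝ) (p : ℕ) :
    (1 - α) * ∑ s ∈ range (2 * p + 1), α ^ ((s + 1) / 2) = 1 + α - 2 * α ^ (p + 1) := by
  induction p with
  | zero => simp; ring
  | succ p ih =>
    have h₁ : (2 * p + 1 + 1) / 2 = p + 1 := by omega
    have h₂ : (2 * p + 1 + 1 + 1) / 2 = p + 1 := by omega
    rw [show 2 * (p + 1) + 1 = 2 * p + 1 + 1 + 1 by ring, sum_range_succ, sum_range_succ, h₁, h₂,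
      mul_add, mul_add, ih]
    ring

lemma one_sub_mul_sum_pow_sub (α : ℝ) (j : ℕ) :
    (1 - α) * ∑ i ∈ range j, α ^ (j - i) = α - α ^ (j + 1) := by
  induction j with
  | zero => simp
  | succ j ih =>
    rw [sum_range_succ']
    simp only [Nat.add_sub_add_right, Nat.sub_zero]
    rw [mul_add, ih]
    ring

/-- Columns in the left half sum to `1`. -/
lemma sum_EM_of_le_half (j p : ℕ) {α : ℝ} (hα0 : 0 < α) (hα1 : α < 1) :
    ∑ i ∈ range (2 * (j + p) + 1), EM (2 * (j + p)) α i j = 1 := by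
  have hmin : min j (2 * (j + p) - j) = j := by omega
  have hhalf : 2 * (j + p) / 2 = j + p := by omega
  have hD := (EM_denom_pos (j + p) hα0 hα1).ne'
  simp only [EM, hmin, hhalf]
  rw [← mul_sum, div_mul_eq_mul_div, div_eq_one_iff_eq hD,
    show 2 * (j + p) + 1 = j + (j + (2 * p + 1)) by ring, sum_range_add, sum_range_add]
  have hleft : ∀ i ∈ range j, (if Nat.dist i j < j then α ^ Nat.dist i j
      else α ^ ((Nat.dist i j + j + 1) / 2)) = α ^ (j - i) := by
    intro i hi
    have hi' := mem_range.mp hi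
    have hd : Nat.dist i j = j - i := Nat.dist_eq_sub_of_le hi'.le
    rw [hd]
    split_ifs
    · rfl
    · congr 1; omega
  have hmid : ∀ t ∈ range j, (if Nat.dist (j + t) j < j then α ^ Nat.dist (j + t) j
      else α ^ ((Nat.dist (j + t) j + j + 1) / 2)) = α ^ t := by
    intro t ht
    have hd : Nat.dist (j + t) j = t := by unfold Nat.dist; omega
    rw [hd, if_pos (mem_range.mp ht)]
  have hright : ∀ s ∈ range (2 * p + 1),
      (if Nat.dist (j + (j + s)) j < j then α ^ Nat.dist (j + (j + s)) j
      else α ^ ((Nat.dist (j + (j + s)) j + j + 1) / 2)) = α ^ j * α ^ ((s + 1) / 2) := by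
    intro s _
    have hd : Nat.dist (j + (j + s)) j = j + s := by unfold Nat.dist; omega
    rw [hd, if_neg (by omega), ← pow_add]
    congr 1; omega
  rw [sum_congr rfl hleft, sum_congr rfl hmid, sum_congr rfl hright, ← mul_sum, mul_add, mul_add,
    one_sub_mul_sum_pow_sub, mul_neg_geom_sum, mul_left_comm, one_sub_mul_sum_pow_half]
  ring

/-- for even `n ≥ 2` and `α ∈ (0,1)`, `EM` is a valid mechanism:
all entries are positive and each column sums to 1. -/
theorem em_is_mechanism (n : ℕ) (α : ℝ) (hn : 2 ≤ n) (heven : Even n)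
    (hα0 : 0 < α) (hα1 : α < 1) :
    (∀ i j, i ≤ n → j ≤ n → 0 < EM n α i j) ∧
    (∀ j, j ≤ n → ∑ i ∈ Finset.range (n + 1), EM n α i j = 1) := by
  obtain ⟨m, rfl⟩ := heven.exists_two_nsmul
  simp only [smul_eq_mul] at *
  refine ⟨fun i j _ _ => ?_, fun j hj => ?_⟩
  · have hD := EM_denom_pos (2 * m / 2) hα0 hα1
    have hN : 0 < 1 - α := sub_pos.mpr hα1
    unfold EM
    split_ifs <;> positivity
  · rcases le_total j m with h | h
    · obtain ⟨p, rfl⟩ := Nat.exists_eq_add_of_le h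
      exact sum_EM_of_le_half j p hα0 hα1
    · obtain ⟨p, hp⟩ := Nat.exists_eq_add_of_le (show 2 * m - j ≤ m by omega)
      have hsum := sum_EM_of_le_half (2 * m - j) p hα0 hα1
      rw [← hp, ← sum_range_reflect] at hsum
      rw [← hsum]
      refine sum_congr rfl fun i hi => ?_
      have hi' := mem_range.mp hi
      rw [show 2 * m + 1 - 1 - i = 2 * m - i by omega, EM_reflect _ _ (by omega) hj]
end

section
/- Let n ≥ 2 be even and α ∈ (0,1). The explicit fair mechanism EM satisfies α-differential privacy: for all i and all 0 ≤ j < n, α·EM i (j+1) ≤ EM i j and α·EM i j ≤ EM i (j+1). -/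
open Finset

/-- The exponent of `α` in `EM n α i j`. -/
def emExponent (n i j : ℕ) : ℕ :=
  if Nat.dist i j < min j (n - j) then Nat.dist i j
  else (Nat.dist i j + min j (n - j) + 1) / 2

theorem EM_eq_mul_pow (n : ℕ) (α : ℝ) (i j : ℕ) :
    EM n α i j = (1 - α) / (1 + α - 2 * α ^ (n / 2 + 1)) * α ^ emExponent n i j := by
  unfold EM emExponent
  split_ifs <;> rfl

theorem emExponent_adjacent {n : ℕ} (heven : Even n) (i : ℕ) {j : ℕ} (hj : j < n) :
    emExponent n i j ≤ emExponent n i (j + 1) + 1 ∧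
      emExponent n i (j + 1) ≤ emExponent n i j + 1 := by
  obtain ⟨m, rfl⟩ := heven
  unfold emExponent Nat.dist
  split_ifs <;> omega

theorem EM_scale_nonneg (n : ℕ) {α : ℝ} (hα0 : 0 < α) (hα1 : α < 1) :
    0 ≤ (1 - α) / (1 + α - 2 * α ^ (n / 2 + 1)) := by
  have h : α ^ (n / 2 + 1) ≤ α := pow_le_of_le_one hα0.le hα1.le (Nat.succ_ne_zero _)
  exact div_nonneg (by linarith) (by linarith)

/-- for even `n ≥ 2` and `α ∈ (0,1)`, `EM` satisfies `α`-differential privacy. -/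
theorem em_is_dp (n : ℕ) (α : ℝ) (hn : 2 ≤ n) (heven : Even n)
    (hα0 : 0 < α) (hα1 : α < 1) :
    IsDP n α (EM n α) := by
  intro i j _ hj
  obtain ⟨h₁, h₂⟩ := emExponent_adjacent heven i hj
  have hy := EM_scale_nonneg n hα0 hα1
  simp only [EM_eq_mul_pow, mul_left_comm α, ← pow_succ']
  exact ⟨mul_le_mul_of_nonneg_left (pow_le_pow_of_le_one hα0.le hα1.le h₁) hy,
    mul_le_mul_of_nonneg_left (pow_le_pow_of_le_one hα0.le hα1.le h₂) hy⟩
end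

section
/- Let n ≥ 2 be even and α ∈ (0,1). The explicit fair mechanism EM is row monotone: for all 1 ≤ j ≤ i, EM i (j−1) ≤ EM i j, and for all i ≤ j < n, EM i (j+1) ≤ EM i j. -/
open Finset

theorem EM_eq_pow_min (n : ℕ) (α : ℝ) (i j : ℕ) :
    EM n α i j = (1 - α) / (1 + α - 2 * α ^ (n / 2 + 1)) *
      α ^ min (Nat.dist i j) ((Nat.dist i j + min j (n - j) + 1) / 2) := by
  unfold EM
  split_ifs with h
  · congr 2
    omega
  · congr 2
    omega

theorem EM_factor_nonneg (n : ℕ) {α : ℝ} (hα0 : 0 ≤ α) (hα1 : α ≤ 1) :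
    0 ≤ (1 - α) / (1 + α - 2 * α ^ (n / 2 + 1)) := by
  have hpow : α ^ (n / 2 + 1) ≤ α := pow_le_of_le_one hα0 hα1 (by omega)
  exact div_nonneg (by linarith) (by linarith)

/-- for even `n ≥ 2` and `α ∈ (0,1)`, `EM` is row monotone. -/
theorem em_row_monotone (n : ℕ) (α : ℝ) (hn : 2 ≤ n) (heven : Even n)
    (hα0 : 0 < α) (hα1 : α < 1) :
    RowMonotone n (EM n α) := by
  obtain ⟨m, rfl⟩ := heven
  constructor
  · intro i j hj hji hi
    rw [EM_eq_pow_min, EM_eq_pow_min]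
    refine mul_le_mul_of_nonneg_left (pow_le_pow_of_le_one hα0.le hα1.le ?_)
      (EM_factor_nonneg _ hα0.le hα1.le)
    unfold Nat.dist
    omega
  · intro i j hij hj
    rw [EM_eq_pow_min, EM_eq_pow_min]
    refine mul_le_mul_of_nonneg_left (pow_le_pow_of_le_one hα0.le hα1.le ?_)
      (EM_factor_nonneg _ hα0.le hα1.le)
    unfold Nat.dist
    omega
end

section
/- Let n ≥ 2 be even and α ∈ (0,1). The explicit fair mechanism EM satisfies weak honesty: its common diagonal value y = (1−α)/(1+α−2α^{n/2+1}) satisfies y ≥ 1/(n+1). -/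
open Finset

/-- for even `n ≥ 2` and `α ∈ (0,1)`, the common diagonal value
`y = (1−α)/(1+α−2α^(n/2+1))` of `EM` satisfies `y ≥ 1/(n+1)` (weak honesty). -/
theorem em_weakly_honest (n : ℕ) (α : ℝ) (hn : 2 ≤ n) (heven : Even n)
    (hα0 : 0 < α) (hα1 : α < 1) :
    1 / ((n : ℝ) + 1) ≤ (1 - α) / (1 + α - 2 * α ^ (n / 2 + 1)) := by
  obtain ⟨m, rfl⟩ := heven
  have hm : (m + m) / 2 = m := by omega
  rw [hm]
  have bernoulli : 1 + ((m + 1 : ℕ) : ℝ) * (α - 1) ≤ α ^ (m + 1) :=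
    one_add_mul_sub_le_pow (by linarith) (m + 1)
  have pow_le : α ^ (m + 1) ≤ α := pow_le_of_le_one hα0.le hα1.le m.succ_ne_zero
  have hpos : (0 : ℝ) < ((m + m : ℕ) : ℝ) + 1 := by positivity
  rw [div_le_div_iff₀ hpos (by linarith)]
  push_cast at bernoulli ⊢
  linarith
end

section
/- Let M be a mechanism of size n and define the symmetrized mechanism M* by M* i j = (M i j + M (n−i) (n−j))/2. If M is row monotone then M* is row monotone; if M satisfies row honesty then M* satisfies row honesty; if M is fair then M* is fair; and if M satisfies weak honesty then M* satisfies weak honesty. -/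
open Finset

/-- the symmetrization `M* i j = (M i j + M (n−i) (n−j))/2` preserves
row monotonicity, row honesty, fairness, and weak honesty. -/
theorem symmetrization_preserves_props (n : ℕ) (M : ℕ → ℕ → ℝ) (hM : IsMechanism n M)
    (Mstar : ℕ → ℕ → ℝ)
    (hMs : ∀ i j, Mstar i j = (M i j + M (n - i) (n - j)) / 2) :
    (RowMonotone n M → RowMonotone n Mstar) ∧
    (RowHonest n M → RowHonest n Mstar) ∧
    (Fair n M → Fair n Mstar) ∧
    (WeaklyHonest n M → WeaklyHonest n Mstar) := by
  refine ⟨fun ⟨hl, hr⟩ => ⟨fun i j h1 hji hi => ?_, fun i j hij hj => ?_⟩,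
    fun h i j hi hj => ?_, fun h i j hi hj => ?_, fun h i hi => ?_⟩
  · have h₂ := hr (n - i) (n - j) (by omega) (by omega)
    rw [show n - j + 1 = n - (j - 1) by omega] at h₂
    rw [hMs, hMs]
    linarith [hl i j h1 hji hi]
  · have h₂ := hl (n - i) (n - j) (by omega) (by omega) (by omega)
    rw [show n - j - 1 = n - (j + 1) by omega] at h₂
    rw [hMs, hMs]
    linarith [hr i j hij hj]
  · rw [hMs, hMs]
    linarith [h i j hi hj, h (n - i) (n - j) (by omega) (by omega)]
  · rw [hMs, hMs, h i j hi hj, h (n - i) (n - j) (by omega) (by omega)]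
  · rw [hMs]
    linarith [h i hi, h (n - i) (by omega)]
end

section
/- Let n ≥ 1, α ∈ (0,1), and let A be the (n+1)×(n+1) Toeplitz matrix with entries A i j = α^|i−j| for i, j ∈ {0,…,n}. If y ∈ ℝ^{n+1} satisfies A·y = 𝟙 (the all-ones vector), i.e., ∑_{j=0}^{n} α^|i−j| y_j = 1 for every i, then y_0 = y_n = 1/(1+α) and y_i = (1−α)/(1+α) for all 0 < i < n. -/
open Finset

theorem pow_dist_eq_mul_of_dist_eq_succ {R : Type*} [CommRing R] (α : R) {a b j : ℕ}
    (h : Nat.dist a j = Nat.dist b j + 1) : α ^ Nat.dist a j = α * α ^ Nat.dist b j := by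
  rw [h, pow_succ']

/-- Subtracting `α` times row `b` from row `a` isolates the coordinate `a`, when `b` is one step
closer than `a` to every other index of `s`. -/
theorem sum_pow_dist_sub_mul_adjacent {R : Type*} [CommRing R] (α : R) (y : ℕ → R)
    (s : Finset ℕ) {a b : ℕ} (ha : a ∈ s) (hab : Nat.dist b a = 1)
    (hs : ∀ j ∈ s, j ≠ a → Nat.dist a j = Nat.dist b j + 1) :
    ∑ j ∈ s, α ^ Nat.dist a j * y j - α * ∑ j ∈ s, α ^ Nat.dist b j * y j =
      (1 - α ^ 2) * y a := by
  rw [Finset.mul_sum, ← Finset.sum_sub_distrib, Finset.sum_eq_single_of_mem a ha]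
  · rw [Nat.dist_self, hab]
    ring
  · intro j hj hja
    rw [pow_dist_eq_mul_of_dist_eq_succ α (hs j hj hja)]
    ring

/-- A three-term combination of consecutive rows of the matrix `α^|i−j|` isolates the middle
coordinate. -/
theorem sum_pow_dist_three_term {R : Type*} [CommRing R] (α : R) (y : ℕ → R)
    (s : Finset ℕ) {i : ℕ} (hi : i + 1 ∈ s) :
    (1 + α ^ 2) * ∑ j ∈ s, α ^ Nat.dist (i + 1) j * y j
        - α * ∑ j ∈ s, α ^ Nat.dist i j * y j
        - α * ∑ j ∈ s, α ^ Nat.dist (i + 2) j * y j =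
      (1 - α ^ 2) * y (i + 1) := by
  simp only [Finset.mul_sum]
  rw [← Finset.sum_sub_distrib, ← Finset.sum_sub_distrib, Finset.sum_eq_single_of_mem (i + 1) hi]
  · have h₁ : Nat.dist i (i + 1) = 1 := by unfold Nat.dist; lia
    have h₂ : Nat.dist (i + 2) (i + 1) = 1 := by unfold Nat.dist; lia
    rw [Nat.dist_self, h₁, h₂]
    ring
  · intro j _ hj
    rcases lt_or_gt_of_ne hj with hlt | hgt
    · have h₁ : Nat.dist (i + 1) j = Nat.dist i j + 1 := by unfold Nat.dist; lia
      have h₂ : Nat.dist (i + 2) j = Nat.dist (i + 1) j + 1 := by unfold Nat.dist; lia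
      rw [pow_dist_eq_mul_of_dist_eq_succ α h₂, pow_dist_eq_mul_of_dist_eq_succ α h₁]
      ring
    · have h₁ : Nat.dist (i + 1) j = Nat.dist (i + 2) j + 1 := by unfold Nat.dist; lia
      have h₂ : Nat.dist i j = Nat.dist (i + 1) j + 1 := by unfold Nat.dist; lia
      rw [pow_dist_eq_mul_of_dist_eq_succ α h₂, pow_dist_eq_mul_of_dist_eq_succ α h₁]
      ring

/-- if `y ∈ ℝ^(n+1)` solves the Toeplitz system
`∑_{j=0}^{n} α^|i−j| y_j = 1` for every `i ∈ {0,…,n}`, then `y_0 = y_n = 1/(1+α)`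
and `y_i = (1−α)/(1+α)` for all `0 < i < n`. -/
theorem toeplitz_system_solution (n : ℕ) (α : ℝ) (hn : 1 ≤ n) (hα0 : 0 < α) (hα1 : α < 1)
    (y : ℕ → ℝ)
    (hy : ∀ i, i ≤ n → ∑ j ∈ Finset.range (n + 1), α ^ Nat.dist i j * y j = 1) :
    y 0 = 1 / (1 + α) ∧ y n = 1 / (1 + α) ∧
    ∀ i, 0 < i → i < n → y i = (1 - α) / (1 + α) := by
  have hne : 1 - α ≠ 0 := by linarith
  have hpos : 1 + α ≠ 0 := by linarith
  refine ⟨?_, ?_, fun i hi0 hin => ?_⟩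
  · have key := sum_pow_dist_sub_mul_adjacent α y (Finset.range (n + 1)) (a := 0) (b := 1)
      (by simp) rfl (fun j _ hj => by unfold Nat.dist; lia)
    rw [hy 0 (by lia), hy 1 hn] at key
    rw [eq_div_iff hpos]
    exact mul_left_cancel₀ hne (by linear_combination -key)
  · have key := sum_pow_dist_sub_mul_adjacent α y (Finset.range (n + 1)) (a := n) (b := n - 1)
      (by simp) (by unfold Nat.dist; lia)
      (fun j hj hjn => by rw [Finset.mem_range] at hj; unfold Nat.dist; lia)
    rw [hy n le_rfl, hy (n - 1) (by lia)] at key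
    rw [eq_div_iff hpos]
    exact mul_left_cancel₀ hne (by linear_combination -key)
  · obtain ⟨i, rfl⟩ := Nat.exists_eq_add_of_lt hi0
    rw [zero_add] at hin ⊢
    have key := sum_pow_dist_three_term α y (Finset.range (n + 1)) (i := i)
      (Finset.mem_range.2 (by lia))
    rw [hy i (by lia), hy (i + 1) (by lia), hy (i + 2) (by lia)] at key
    rw [eq_div_iff hpos]
    exact mul_left_cancel₀ hne (by linear_combination -key)
end
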